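/- Let G be a group with a finite symmetric generating set S, let R ≥ 0, and let F ⊆ G be a finite nonempty subset contained in the ball {g ∈ G : |g| ≤ R}. Let ξ = 𝟙_F / |F| be the normalized indicator of F, and let s ∈ S. Then Trc(ρ_s ξ^∨, ξ^∨) ≤ (2R + 1) · |sF Δ F| / (2 |F|), where sF = {s*g : g ∈ F} and Δ denotes symmetric difference. -/

import Mathlib

open Filter Topology

/-- Word length of `g` with respect to the generating set `S`. -/
noncomputable def wordLength {G : Type*} [Group G] (S : Finset G) (g : G) : ℕ :=
  sInf {n : ℕ | ∃ l : List G, l.length = n ∧ (∀ x ∈ l, x ∈ S) ∧ l.prod = g}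

/-- Cayley graph distance `d(x,y) = |y * x⁻¹|`. -/
noncomputable def cayleyDist {G : Type*} [Group G] (S : Finset G) (x y : G) : ℝ :=
  (wordLength S (y * x⁻¹) : ℝ)

/-- Partial gradient `∇ₛ f (x) = f (s⁻¹ x) - f x`. -/
def grad {G : Type*} [Group G] (s : G) (f : G → ℝ) : G → ℝ :=
  fun x => f (s⁻¹ * x) - f x

/-- `f` is `p`-summable. -/
def MemLp' {G : Type*} (p : ℝ) (f : G → ℝ) : Prop :=
  Summable fun x => |f x| ^ p

/-- The `ℓ^p` norm of `f`. -/
noncomputable def lpNorm {G : Type*} (p : ℝ) (f : G → ℝ) : ℝ :=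
  (∑' x, |f x| ^ p) ^ (1 / p)

/-- `f` is `p`-Dirichlet: every partial gradient is in `ℓ^p`. -/
def IsDirichlet {G : Type*} [Group G] (S : Finset G) (p : ℝ) (f : G → ℝ) : Prop :=
  ∀ s ∈ S, MemLp' p (grad s f)

/-- Convolution `(ξ * f)(x) = ∑ ξ γ • f (γ⁻¹ x)`. -/
noncomputable def conv {G : Type*} [Group G] (ξ f : G → ℝ) : G → ℝ :=
  fun x => ∑' γ, ξ γ * f (γ⁻¹ * x)

/-- A finitely supported probability measure on `G`. -/
def IsProbMeasure {G : Type*} (ξ : G → ℝ) : Prop :=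
  (∀ x, 0 ≤ ξ x) ∧ (Function.support ξ).Finite ∧ (∑' x, ξ x) = 1

/-- `ξ^∨ (x) = ξ (x⁻¹)`. -/
def invMeasure {G : Type*} [Group G] (ξ : G → ℝ) : G → ℝ := fun x => ξ x⁻¹

/-- `(ρ_s ξ^∨)(x) = ξ^∨ (x * s)`. -/
def rhoInvMeasure {G : Type*} [Group G] (ξ : G → ℝ) (s : G) : G → ℝ :=
  fun x => ξ (x * s)⁻¹

/-- `m` is a coupling of `ξ` and `φ`. -/
def IsCoupling {G : Type*} (m : G × G → ℝ) (ξ φ : G → ℝ) : Prop :=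
  (∀ z, 0 ≤ m z) ∧ (Function.support m).Finite ∧
    (∀ x, (∑' y, m (x, y)) = ξ x) ∧ (∀ y, (∑' x, m (x, y)) = φ y)

/-- The transportation cost between `ξ` and `φ`, for the Cayley distance of `(G,S)`. -/
noncomputable def Trc {G : Type*} [Group G] (S : Finset G) (ξ φ : G → ℝ) : ℝ :=
  sInf {c : ℝ | ∃ m, IsCoupling m ξ φ ∧ c = ∑' z : G × G, m z * cayleyDist S z.1 z.2}

/-- `G` is transport amenable (with respect to `S`). -/
def TransportAmenable {G : Type*} [Group G] (S : Finset G) : Prop :=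
  ∃ K > (0 : ℝ), ∃ ξ : ℕ → G → ℝ,
    (∀ n, IsProbMeasure (ξ n)) ∧
    (∀ γ : G, Tendsto (fun n => ∑' x, |ξ n (γ⁻¹ * x) - ξ n x|) atTop (𝓝 0)) ∧
    (∀ s ∈ S, ∀ n, Trc S (rhoInvMeasure (ξ n) s) (invMeasure (ξ n)) ≤ K)
open Classical in
/-- The translate `s • F` of a finite set. -/
noncomputable def leftTranslate {G : Type*} [Group G] (s : G) (F : Finset G) : Finset G :=
  F.image (fun g => s * g)

open Classical in
/-- Symmetric difference of two finite sets. -/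
noncomputable def finsetSymmDiff {G : Type*} (A B : Finset G) : Finset G :=
  (A \ B) ∪ (B \ A)

open Classical in
/-- The normalized indicator function of a finite set. -/
noncomputable def normIndicator {G : Type*} (F : Finset G) : G → ℝ :=
  fun x => if x ∈ F then ((F.card : ℝ))⁻¹ else 0

section WordLength

variable {G : Type*} [Group G] {S : Finset G}

theorem wordLength_le_length {l : List G} (hl : ∀ x ∈ l, x ∈ S) :
    wordLength S l.prod ≤ l.length :=
  Nat.sInf_le ⟨l, rfl, hl, rfl⟩

open scoped Pointwise in
theorem exists_list_length_eq_wordLength (hsym : ∀ s ∈ S, s⁻¹ ∈ S)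
    (hgen : Subgroup.closure (S : Set G) = ⊤) (g : G) :
    ∃ l : List G, l.length = wordLength S g ∧ (∀ x ∈ l, x ∈ S) ∧ l.prod = g := by
  refine Nat.sInf_mem
    (s := {n : ℕ | ∃ l : List G, l.length = n ∧ (∀ x ∈ l, x ∈ S) ∧ l.prod = g}) ?_
  obtain ⟨l, hl, hprod⟩ := Submonoid.exists_list_of_mem_closure
    (show g ∈ Submonoid.closure ((S : Set G) ∪ (S : Set G)⁻¹) by
      rw [← Subgroup.closure_toSubmonoid, hgen]; trivial)
  refine ⟨l.length, l, rfl, fun x hx => ?_, hprod⟩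
  rcases hl x hx with h | h
  · exact h
  · simpa using hsym _ h

theorem wordLength_mul_le (hsym : ∀ s ∈ S, s⁻¹ ∈ S)
    (hgen : Subgroup.closure (S : Set G) = ⊤) (g h : G) :
    wordLength S (g * h) ≤ wordLength S g + wordLength S h := by
  obtain ⟨l, hl, hlS, rfl⟩ := exists_list_length_eq_wordLength hsym hgen g
  obtain ⟨k, hk, hkS, rfl⟩ := exists_list_length_eq_wordLength hsym hgen h
  rw [← hl, ← hk, ← List.prod_append, ← List.length_append]
  refine wordLength_le_length fun x hx => ?_
  rcases List.mem_append.1 hx with h | h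
  exacts [hlS x h, hkS x h]

theorem wordLength_inv_le (hsym : ∀ s ∈ S, s⁻¹ ∈ S)
    (hgen : Subgroup.closure (S : Set G) = ⊤) (g : G) :
    wordLength S g⁻¹ ≤ wordLength S g := by
  obtain ⟨l, hl, hlS, rfl⟩ := exists_list_length_eq_wordLength hsym hgen g
  rw [← hl, List.prod_inv_reverse]
  refine (wordLength_le_length fun x hx => ?_).trans (by simp)
  obtain ⟨y, hy, rfl⟩ := List.mem_map.1 (List.mem_reverse.1 hx)
  exact hsym y (hlS y hy)

theorem wordLength_le_one {s : G} (hs : s ∈ S) : wordLength S s ≤ 1 := by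
  simpa using wordLength_le_length (S := S) (l := [s]) (by simpa using hs)

theorem wordLength_one : wordLength S (1 : G) = 0 := by
  simpa using wordLength_le_length (S := S) (l := []) (by simp)

theorem cayleyDist_self (x : G) : cayleyDist S x x = 0 := by
  simp [cayleyDist, wordLength_one]

theorem Trc_le {ξ φ : G → ℝ} {m : G × G → ℝ} (hm : IsCoupling m ξ φ) :
    Trc S ξ φ ≤ ∑' z : G × G, m z * cayleyDist S z.1 z.2 := by
  refine csInf_le ⟨0, ?_⟩ ⟨m, hm, rfl⟩
  rintro _ ⟨m', hm', rfl⟩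
  exact tsum_nonneg fun z => mul_nonneg (hm'.1 z) (Nat.cast_nonneg _)

end WordLength

/-- Two finite sets of equal size are matched by a bijection fixing their intersection. -/
theorem exists_bijOn_eq_self_on_inter {α : Type*} (A B : Finset α) (h : A.card = B.card) :
    ∃ σ : α → α, Set.BijOn σ A B ∧ ∀ x ∈ A, x ∈ B → σ x = x := by
  classical
  let e : ↥(A \ B) ≃ ↥(B \ A) := Finset.equivOfCardEq (Finset.card_sdiff_comm h)
  have he : ∀ x, (e x : α) ∈ B ∧ (e x : α) ∉ A := fun x => Finset.mem_sdiff.1 (e x).2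
  refine ⟨fun x => if hx : x ∈ A \ B then e ⟨x, hx⟩ else x, ⟨?_, ?_, ?_⟩, ?_⟩
  · intro x hx
    by_cases hB : x ∈ B
    · simp [hB]
    · have hx' : x ∈ A \ B := Finset.mem_sdiff.2 ⟨hx, hB⟩
      simp only [hx', dite_true]
      exact Finset.mem_coe.2 (he ⟨x, hx'⟩).1
  · intro x hx y hy hxy
    rw [Finset.mem_coe] at hx hy
    by_cases hxB : x ∈ A \ B <;> by_cases hyB : y ∈ A \ B <;>
      simp only [hxB, hyB, dite_true, dite_false] at hxy
    · simpa using e.injective (Subtype.ext hxy)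
    · exact absurd (hxy ▸ hy) (he _).2
    · exact absurd (hxy ▸ hx) (he _).2
    · exact hxy
  · intro y hy
    by_cases hyA : y ∈ A
    · exact ⟨y, hyA, by simp [Finset.mem_coe.1 hy]⟩
    · have hy' : y ∈ B \ A := Finset.mem_sdiff.2 ⟨hy, hyA⟩
      refine ⟨e.symm ⟨y, hy'⟩, (Finset.mem_sdiff.1 (e.symm ⟨y, hy'⟩).2).1, ?_⟩
      have h2 := (e.symm ⟨y, hy'⟩).2
      simp only [h2, dite_true, Subtype.coe_eta, Equiv.apply_symm_apply]
  · intro x _ hxB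
    simp [hxB]

open Classical in
/-- The measure of mass `c` at every point of the graph of `σ` over `A`. -/
noncomputable def graphMeasure {G : Type*} (A : Finset G) (σ : G → G) (c : ℝ) : G × G → ℝ :=
  fun z => if z.1 ∈ A ∧ z.2 = σ z.1 then c else 0

open Classical in
theorem isCoupling_graphMeasure {G : Type*} {A B : Finset G} {σ : G → G} {c : ℝ}
    (hσ : Set.BijOn σ A B) (hc : 0 ≤ c) :
    IsCoupling (graphMeasure A σ c) (fun x => if x ∈ A then c else 0)
      (fun y => if y ∈ B then c else 0) := by
  refine ⟨fun z => ?_, ?_, fun x => ?_, fun y => ?_⟩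
  · unfold graphMeasure
    split_ifs
    exacts [hc, le_rfl]
  · refine (A.image fun a => (a, σ a)).finite_toSet.subset fun z hz => ?_
    have hz' : z.1 ∈ A ∧ z.2 = σ z.1 := by
      by_contra h
      exact hz (if_neg h)
    exact Finset.mem_coe.2 (Finset.mem_image.2 ⟨z.1, hz'.1, Prod.ext rfl hz'.2.symm⟩)
  · by_cases hx : x ∈ A <;> simp [graphMeasure, hx]
  · by_cases hy : y ∈ B
    · obtain ⟨a, ha, rfl⟩ := hσ.surjOn hy
      rw [tsum_eq_single a]
      · exact (if_pos ⟨ha, rfl⟩).trans (if_pos hy).symm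
      · intro x hx
        exact if_neg fun h => hx (hσ.injOn h.1 ha h.2.symm)
    · have h0 : ∀ x, graphMeasure A σ c (x, y) = 0 := fun x =>
        if_neg fun h : x ∈ A ∧ y = σ x => hy (h.2 ▸ hσ.mapsTo h.1)
      simp [h0, hy]

theorem tsum_graphMeasure_mul {G : Type*} (A : Finset G) (σ : G → G) (c : ℝ)
    (d : G × G → ℝ) :
    ∑' z, graphMeasure A σ c z * d z = ∑ a ∈ A, c * d (a, σ a) := by
  classical
  rw [tsum_eq_sum (s := A.image fun a => (a, σ a)),
    Finset.sum_image fun a _ b _ h => congrArg Prod.fst h]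
  · refine Finset.sum_congr rfl fun a ha => ?_
    simp [graphMeasure, ha]
  · intro z hz
    have h0 : graphMeasure A σ c z = 0 := if_neg fun h =>
      hz (Finset.mem_image.2 ⟨z.1, h.1, Prod.ext rfl h.2.symm⟩)
    simp [h0]

open Classical in
/-- Transporting a uniform mass `c` from `A` to `B` costs at most `c * D` per point of `A \ B`,
when `D` bounds the distances between `A` and `B`. -/
theorem Trc_indicator_le {G : Type*} [Group G] (S : Finset G) {A B : Finset G}
    (hcard : A.card = B.card) {c D : ℝ} (hc : 0 ≤ c)
    (hD : ∀ a ∈ A, ∀ b ∈ B, cayleyDist S a b ≤ D) :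
    Trc S (fun x => if x ∈ A then c else 0) (fun y => if y ∈ B then c else 0) ≤
      (A \ B).card * (c * D) := by
  obtain ⟨σ, hσ, hfix⟩ := exists_bijOn_eq_self_on_inter A B hcard
  refine (Trc_le (isCoupling_graphMeasure hσ hc)).trans ?_
  rw [tsum_graphMeasure_mul A σ c fun z => cayleyDist S z.1 z.2,
    ← Finset.sum_subset (Finset.sdiff_subset : A \ B ⊆ A), ← nsmul_eq_mul]
  · refine Finset.sum_le_card_nsmul _ _ _ fun a ha => ?_
    have haA := (Finset.mem_sdiff.1 ha).1
    exact mul_le_mul_of_nonneg_left (hD a haA _ (hσ.mapsTo haA)) hc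
  · intro a haA ha
    have haB : a ∈ B := by
      by_contra h
      exact ha (Finset.mem_sdiff.2 ⟨haA, h⟩)
    simp [hfix a haA haB, cayleyDist_self]

theorem card_finsetSymmDiff_of_card_eq {G : Type*} {A B : Finset G} [DecidableEq G]
    (h : A.card = B.card) : (finsetSymmDiff A B).card = 2 * (A \ B).card := by
  have hdisj : Disjoint (A \ B) (B \ A) :=
    Finset.disjoint_left.2 fun x hx hx' => (Finset.mem_sdiff.1 hx).2 (Finset.mem_sdiff.1 hx').1
  have hunion : finsetSymmDiff A B = (A \ B) ∪ (B \ A) := by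
    ext; simp [finsetSymmDiff]
  rw [hunion, Finset.card_union_of_disjoint hdisj, Finset.card_sdiff_comm h, two_mul]

open scoped Pointwise in
theorem transport_cost_of_normalized_indicator_in_ball
    {G : Type*} [Group G] (S : Finset G)
    (hsym : ∀ s ∈ S, s⁻¹ ∈ S) (hgen : Subgroup.closure (S : Set G) = ⊤)
    (R : ℝ) (hR : 0 ≤ R) (F : Finset G) (hne : F.Nonempty)
    (hball : ∀ g ∈ F, (wordLength S g : ℝ) ≤ R)
    (s : G) (hs : s ∈ S) :
    Trc S (rhoInvMeasure (normIndicator F) s) (invMeasure (normIndicator F)) ≤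
      (2 * R + 1) * ((finsetSymmDiff (leftTranslate s F) F).card : ℝ) / (2 * F.card) := by
  classical
  have hmem : ∀ x, x ∈ leftTranslate s F ↔ s⁻¹ * x ∈ F := fun x => by
    simp only [leftTranslate, Finset.mem_image]
    exact ⟨by rintro ⟨g, hg, rfl⟩; simpa using hg, fun h => ⟨_, h, by simp⟩⟩
  have hcard : (leftTranslate s F).card = F.card :=
    Finset.card_image_of_injective F (mul_right_injective s)
  have hD : ∀ a ∈ (leftTranslate s F)⁻¹, ∀ b ∈ F⁻¹, cayleyDist S a b ≤ 2 * R + 1 := by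
    intro a ha b hb
    rw [Finset.mem_inv', hmem] at ha
    rw [Finset.mem_inv'] at hb
    have heq : b * a⁻¹ = b * (s * (s⁻¹ * a⁻¹)) := by group
    have h1 := wordLength_mul_le hsym hgen b (s * (s⁻¹ * a⁻¹))
    have h2 := wordLength_mul_le hsym hgen s (s⁻¹ * a⁻¹)
    have h3 := wordLength_inv_le hsym hgen b⁻¹
    have h4 := wordLength_le_one hs
    rw [inv_inv] at h3
    have h5 : (wordLength S (b * a⁻¹) : ℝ) ≤
        wordLength S b⁻¹ + 1 + wordLength S (s⁻¹ * a⁻¹) := by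
      rw [heq]
      exact_mod_cast (by omega)
    unfold cayleyDist
    linarith [hball _ ha, hball _ hb]
  have hrho : rhoInvMeasure (normIndicator F) s =
      fun x => if x ∈ (leftTranslate s F)⁻¹ then (F.card : ℝ)⁻¹ else 0 := by
    ext x
    simp only [rhoInvMeasure, normIndicator, Finset.mem_inv', hmem, mul_inv_rev]
  have hinv : invMeasure (normIndicator F) =
      fun x => if x ∈ F⁻¹ then (F.card : ℝ)⁻¹ else 0 := by
    ext x
    simp only [invMeasure, normIndicator, Finset.mem_inv']
  have hsdiff : ((leftTranslate s F)⁻¹ \ F⁻¹).card ≤ (leftTranslate s F \ F).card := by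
    refine Finset.card_le_card_of_injOn (fun x => x⁻¹) (fun x hx => ?_) inv_injective.injOn
    simpa using hx
  have hle := Trc_indicator_le S (A := (leftTranslate s F)⁻¹) (B := F⁻¹)
    (by simp [hcard]) (inv_nonneg.2 (Nat.cast_nonneg (α := ℝ) F.card)) hD
  rw [hrho, hinv, card_finsetSymmDiff_of_card_eq hcard]
  have hpos : (0 : ℝ) < F.card := Nat.cast_pos.2 hne.card_pos
  calc _ ≤ (((leftTranslate s F)⁻¹ \ F⁻¹).card : ℝ) * ((F.card : ℝ)⁻¹ * (2 * R + 1)) := by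
        convert hle
    _ ≤ ((leftTranslate s F \ F).card : ℝ) * ((F.card : ℝ)⁻¹ * (2 * R + 1)) := by
        gcongr
    _ = _ := by
        push_cast
        field_simp
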